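/- There exists a constant C > 0 such that for every q ∈ Q, the smallest Sturm–Liouville eigenvalue satisfies |∫₀¹ (q(x) − 1/2)·sin²(πx) dx − (1/2)·(λ(q) − π² − 1/2)| ≤ C·‖q − 1/2‖∞². -/

import Mathlib

/-- The supremum norm of a real function over the interval `[0,1]`. -/
noncomputable def supNorm (f : ℝ → ℝ) : ℝ := ⨆ x : Set.Icc (0:ℝ) 1, |f x|

/-- The class `Q` of functions `q : [0,1] → [0,1]` that are twice continuously
differentiable with `‖q‖∞ ≤ 1`, `‖q′‖∞ ≤ 1` and `‖q″‖∞ ≤ 1`. -/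
def memQ (q : ℝ → ℝ) : Prop :=
  (∀ x ∈ Set.Icc (0:ℝ) 1, q x ∈ Set.Icc (0:ℝ) 1) ∧
  ContDiffOn ℝ 2 q (Set.Icc 0 1) ∧
  supNorm q ≤ 1 ∧
  supNorm (derivWithin q (Set.Icc 0 1)) ≤ 1 ∧
  supNorm (derivWithin (derivWithin q (Set.Icc 0 1)) (Set.Icc 0 1)) ≤ 1

/-- The smallest Sturm–Liouville eigenvalue `λ(q)`, defined variationally as the
infimum of the Rayleigh quotient over nonzero `C¹` functions `u` on `[0,1]`
vanishing at the endpoints. -/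
noncomputable def lambdaSL (q : ℝ → ℝ) : ℝ :=
  sInf { r : ℝ | ∃ u : ℝ → ℝ, ContDiffOn ℝ 1 u (Set.Icc 0 1) ∧ u 0 = 0 ∧ u 1 = 0 ∧
    (∃ x ∈ Set.Icc (0:ℝ) 1, u x ≠ 0) ∧
    r = (∫ x in (0:ℝ)..1, ((derivWithin u (Set.Icc 0 1) x)^2 + q x * (u x)^2)) /
        (∫ x in (0:ℝ)..1, (u x)^2) }

open Set intervalIntegral MeasureTheory

lemma two_mul_le_sin_pi_mul {x : ℝ} (h0 : 0 ≤ x) (h1 : x ≤ 1 / 2) :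
    2 * x ≤ Real.sin (Real.pi * x) := by
  have hpi := Real.pi_pos
  have h := Real.mul_le_sin (x := Real.pi * x) (by positivity) (by nlinarith)
  have : 2 / Real.pi * (Real.pi * x) = 2 * x := by field_simp
  linarith

lemma sin_pi_mul_one_sub (x : ℝ) : Real.sin (Real.pi * (1 - x)) = Real.sin (Real.pi * x) := by
  rw [mul_sub, mul_one, Real.sin_pi_sub]

lemma sin_pi_mul_pos {x : ℝ} (hx : x ∈ Ioo (0 : ℝ) 1) : 0 < Real.sin (Real.pi * x) :=
  Real.sin_pos_of_pos_of_lt_pi (mul_pos Real.pi_pos hx.1) (by nlinarith [Real.pi_pos, hx.2])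

lemma sin_pi_mul_le_sin_pi_mul {x y : ℝ} (h0 : 0 ≤ x) (hxy : x ≤ y) (hy : y ≤ 1 / 2) :
    Real.sin (Real.pi * x) ≤ Real.sin (Real.pi * y) := by
  have hpi := Real.pi_pos
  exact Real.sin_le_sin_of_le_of_le_pi_div_two (by nlinarith) (by nlinarith) (by gcongr)

lemma hasDerivAt_sin_pi_mul (x : ℝ) :
    HasDerivAt (fun t => Real.sin (Real.pi * t)) (Real.pi * Real.cos (Real.pi * x)) x := by
  simpa [mul_comm] using ((hasDerivAt_id x).const_mul Real.pi).sin

lemma hasDerivAt_cos_pi_mul (x : ℝ) :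
    HasDerivAt (fun t => Real.cos (Real.pi * t)) (-(Real.pi * Real.sin (Real.pi * x))) x := by
  simpa [mul_comm] using ((hasDerivAt_id x).const_mul Real.pi).cos

lemma integral_sin_pi_mul_sq : ∫ x in (0 : ℝ)..1, Real.sin (Real.pi * x) ^ 2 = 1 / 2 := by
  have h := intervalIntegral.integral_comp_mul_left (a := 0) (b := 1)
    (fun x => Real.sin x ^ 2) Real.pi_ne_zero
  rw [h, mul_zero, mul_one, integral_sin_sq]
  have := Real.pi_ne_zero
  simp
  field_simp

lemma integral_cos_pi_mul_sq : ∫ x in (0 : ℝ)..1, Real.cos (Real.pi * x) ^ 2 = 1 / 2 := by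
  have h := intervalIntegral.integral_comp_mul_left (a := 0) (b := 1)
    (fun x => Real.cos x ^ 2) Real.pi_ne_zero
  rw [h, mul_zero, mul_one, integral_cos_sq]
  have := Real.pi_ne_zero
  simp
  field_simp

lemma intervalIntegrable_of_continuousOn_Icc {f : ℝ → ℝ} (hf : ContinuousOn f (Icc 0 1))
    {a b : ℝ} (ha : a ∈ Icc (0 : ℝ) 1) (hb : b ∈ Icc (0 : ℝ) 1) :
    IntervalIntegrable f volume a b :=
  (hf.mono (uIcc_subset_Icc ha hb)).intervalIntegrable

/-- A primitive of `f · sin²(π ·)` vanishing at both endpoints of `[0,1]` is dominated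
by `sin²(π ·)`. -/
lemma abs_integral_mul_sin_sq_le {f : ℝ → ℝ} {M : ℝ} (hf : ContinuousOn f (Icc 0 1))
    (hM : ∀ x ∈ Icc (0 : ℝ) 1, |f x| ≤ 2 * M)
    (hzero : ∫ x in (0 : ℝ)..1, f x * Real.sin (Real.pi * x) ^ 2 = 0)
    {x : ℝ} (hx : x ∈ Icc (0 : ℝ) 1) :
    |∫ t in (0 : ℝ)..x, f t * Real.sin (Real.pi * t) ^ 2| ≤ M * Real.sin (Real.pi * x) ^ 2 := by
  have hM0 : 0 ≤ M := by
    have := (abs_nonneg _).trans (hM 0 (by simp))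
    linarith
  have hcont : ContinuousOn (fun t => f t * Real.sin (Real.pi * t) ^ 2) (Icc 0 1) :=
    hf.mul (by fun_prop)
  have key : ∀ t ∈ Icc (0 : ℝ) 1, Real.sin (Real.pi * t) ≤ Real.sin (Real.pi * x) →
      ‖f t * Real.sin (Real.pi * t) ^ 2‖ ≤ 2 * M * Real.sin (Real.pi * x) ^ 2 := by
    intro t ht hle
    have hs : 0 ≤ Real.sin (Real.pi * t) :=
      Real.sin_nonneg_of_nonneg_of_le_pi (mul_nonneg Real.pi_pos.le ht.1)
        (by nlinarith [Real.pi_pos, ht.2])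
    rw [Real.norm_eq_abs, abs_mul, abs_of_nonneg (sq_nonneg (Real.sin _))]
    exact mul_le_mul (hM t ht) (pow_le_pow_left₀ hs hle 2) (sq_nonneg _) (by linarith)
  have hs2 : 0 ≤ M * Real.sin (Real.pi * x) ^ 2 := by positivity
  rcases le_total x (1 / 2) with h | h
  · have := norm_integral_le_of_norm_le_const (a := 0) (b := x)
      (f := fun t => f t * Real.sin (Real.pi * t) ^ 2)
      (C := 2 * M * Real.sin (Real.pi * x) ^ 2) (by
        intro t ht
        rw [uIoc_of_le hx.1] at ht
        exact key t ⟨ht.1.le, ht.2.trans hx.2⟩ (sin_pi_mul_le_sin_pi_mul ht.1.le ht.2 h))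
    rw [Real.norm_eq_abs, sub_zero, abs_of_nonneg hx.1] at this
    nlinarith
  · have hsplit := integral_add_adjacent_intervals
      (intervalIntegrable_of_continuousOn_Icc hcont (left_mem_Icc.2 zero_le_one) hx)
      (intervalIntegrable_of_continuousOn_Icc hcont hx (right_mem_Icc.2 zero_le_one))
    rw [hzero] at hsplit
    have := norm_integral_le_of_norm_le_const (a := x) (b := 1)
      (f := fun t => f t * Real.sin (Real.pi * t) ^ 2)
      (C := 2 * M * Real.sin (Real.pi * x) ^ 2) (by
        intro t ht
        rw [uIoc_of_le hx.2] at ht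
        refine key t ⟨hx.1.trans ht.1.le, ht.2⟩ ?_
        rw [← sin_pi_mul_one_sub t, ← sin_pi_mul_one_sub x]
        exact sin_pi_mul_le_sin_pi_mul (by linarith [ht.2]) (by linarith [ht.1]) (by linarith))
    rw [Real.norm_eq_abs, abs_of_nonneg (sub_nonneg.2 hx.2)] at this
    rw [eq_neg_of_add_eq_zero_left hsplit, abs_neg]
    nlinarith

/-- A `C¹` function on `[0,1]` vanishing at the endpoints is dominated by `sin (π ·)`. -/
lemma exists_abs_le_mul_sin {u : ℝ → ℝ} (hu : ContDiffOn ℝ 1 u (Icc 0 1))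
    (h0 : u 0 = 0) (h1 : u 1 = 0) :
    ∃ L : ℝ, 0 ≤ L ∧ ∀ x ∈ Icc (0 : ℝ) 1, |u x| ≤ L * Real.sin (Real.pi * x) := by
  have hud := uniqueDiffOn_Icc (zero_lt_one (α := ℝ))
  obtain ⟨L, hL⟩ := isCompact_Icc.exists_bound_of_continuousOn
    (hu.continuousOn_derivWithin hud le_rfl)
  have hL0 : 0 ≤ L := (norm_nonneg _).trans (hL 0 (by simp))
  have hlip : ∀ x ∈ Icc (0 : ℝ) 1, ∀ y ∈ Icc (0 : ℝ) 1, ‖u y - u x‖ ≤ L * ‖y - x‖ :=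
    fun x hx y hy => (convex_Icc (0 : ℝ) 1).norm_image_sub_le_of_norm_derivWithin_le
      (hu.differentiableOn one_ne_zero) hL hx hy
  refine ⟨L, hL0, fun x hx => ?_⟩
  rcases le_total x (1 / 2) with h | h
  · have := hlip 0 (by simp) x hx
    rw [h0, sub_zero, sub_zero, Real.norm_eq_abs, Real.norm_eq_abs, abs_of_nonneg hx.1] at this
    exact this.trans (mul_le_mul_of_nonneg_left
      (by linarith [two_mul_le_sin_pi_mul hx.1 h, hx.1]) hL0)
  · have := hlip x hx 1 (by simp)
    rw [h1, zero_sub, norm_neg, Real.norm_eq_abs, Real.norm_eq_abs,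
      abs_of_nonneg (sub_nonneg.2 hx.2)] at this
    have h2 := two_mul_le_sin_pi_mul (sub_nonneg.2 hx.2) (by linarith : 1 - x ≤ 1 / 2)
    rw [sin_pi_mul_one_sub] at h2
    exact this.trans (mul_le_mul_of_nonneg_left (by linarith [hx.2]) hL0)

/-- Perturbed Wirtinger inequality, by means of a logarithmic derivative
`π cot(πx) + g(x)` of an approximate ground state, where
`sin²(πx) g(x) = ∫₀ˣ (p - 2 ∫₀¹ p sin²(π ·)) sin²(π ·)`. -/
lemma rayleigh_lower_bound {p u : ℝ → ℝ} {M : ℝ} (hp : ContinuousOn p (Icc 0 1))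
    (hM : ∀ x ∈ Icc (0 : ℝ) 1, |p x| ≤ M) (hu : ContDiffOn ℝ 1 u (Icc 0 1))
    (h0 : u 0 = 0) (h1 : u 1 = 0) :
    (Real.pi ^ 2 + 2 * (∫ x in (0 : ℝ)..1, p x * Real.sin (Real.pi * x) ^ 2) - M ^ 2) *
        ∫ x in (0 : ℝ)..1, u x ^ 2 ≤
      ∫ x in (0 : ℝ)..1, ((derivWithin u (Icc 0 1) x) ^ 2 + p x * u x ^ 2) := by
  have hud := uniqueDiffOn_Icc (zero_lt_one (α := ℝ))
  have hmem0 : (0 : ℝ) ∈ Icc (0 : ℝ) 1 := by simp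
  have hmem1 : (1 : ℝ) ∈ Icc (0 : ℝ) 1 := by simp
  have hcu : ContinuousOn u (Icc 0 1) := hu.continuousOn
  have hcu' := hu.continuousOn_derivWithin hud le_rfl
  set P : ℝ := 2 * ∫ x in (0 : ℝ)..1, p x * Real.sin (Real.pi * x) ^ 2 with hP
  have hM0 : 0 ≤ M := (abs_nonneg _).trans (hM 0 hmem0)
  have hcs : ContinuousOn (fun x => Real.sin (Real.pi * x) ^ 2) (Icc 0 1) := by fun_prop
  have hcps : ContinuousOn (fun x => p x * Real.sin (Real.pi * x) ^ 2) (Icc 0 1) := hp.mul hcs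
  have hPM : |P| ≤ M := by
    have h : |∫ x in (0 : ℝ)..1, p x * Real.sin (Real.pi * x) ^ 2| ≤
        ∫ x in (0 : ℝ)..1, M * Real.sin (Real.pi * x) ^ 2 := by
      refine (abs_integral_le_integral_abs zero_le_one).trans
        (integral_mono_on zero_le_one
          (intervalIntegrable_of_continuousOn_Icc hcps.abs hmem0 hmem1)
          (intervalIntegrable_of_continuousOn_Icc (hcs.const_mul M) hmem0 hmem1) ?_)
      intro x hx
      rw [abs_mul, abs_of_nonneg (sq_nonneg (Real.sin _))]
      exact mul_le_mul_of_nonneg_right (hM x hx) (sq_nonneg _)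
    rw [intervalIntegral.integral_const_mul, integral_sin_pi_mul_sq] at h
    rw [hP, abs_mul, abs_two]
    linarith
  have hcf : ContinuousOn (fun x => p x - P) (Icc 0 1) := hp.sub continuousOn_const
  have hcfs : ContinuousOn (fun x => (p x - P) * Real.sin (Real.pi * x) ^ 2) (Icc 0 1) :=
    hcf.mul hcs
  have hzero : ∫ x in (0 : ℝ)..1, (p x - P) * Real.sin (Real.pi * x) ^ 2 = 0 := by
    simp only [sub_mul]
    rw [intervalIntegral.integral_sub
      (intervalIntegrable_of_continuousOn_Icc hcps hmem0 hmem1)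
      (intervalIntegrable_of_continuousOn_Icc (hcs.const_mul P) hmem0 hmem1),
      intervalIntegral.integral_const_mul, integral_sin_pi_mul_sq, hP]
    ring
  set A : ℝ → ℝ := fun x => ∫ t in (0 : ℝ)..x, (p t - P) * Real.sin (Real.pi * t) ^ 2
  have hAle : ∀ x ∈ Icc (0 : ℝ) 1, |A x| ≤ M * Real.sin (Real.pi * x) ^ 2 := fun x hx =>
    abs_integral_mul_sin_sq_le hcf (fun y hy => (abs_sub _ _).trans (by linarith [hM y hy]))
      hzero hx
  have hAderiv : ∀ x ∈ Ioo (0 : ℝ) 1,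
      HasDerivAt A ((p x - P) * Real.sin (Real.pi * x) ^ 2) x := fun x hx =>
    integral_hasDerivAt_right
      (intervalIntegrable_of_continuousOn_Icc hcfs hmem0 (Ioo_subset_Icc_self hx))
      ((hcfs.mono Ioo_subset_Icc_self).stronglyMeasurableAtFilter isOpen_Ioo x hx)
      (hcfs.continuousAt (Icc_mem_nhds hx.1 hx.2))
  set w : ℝ → ℝ := fun x => Real.pi * Real.cos (Real.pi * x) / Real.sin (Real.pi * x) +
    A x / Real.sin (Real.pi * x) ^ 2 with hw
  have hgle : ∀ x ∈ Icc (0 : ℝ) 1, |A x / Real.sin (Real.pi * x) ^ 2| ≤ M := by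
    intro x hx
    rw [abs_div, abs_of_nonneg (sq_nonneg (Real.sin _))]
    exact div_le_of_le_mul₀ (sq_nonneg _) hM0 (hAle x hx)
  have hwderiv : ∀ x ∈ Ioo (0 : ℝ) 1, HasDerivAt w
      (p x - P - Real.pi ^ 2 + (A x / Real.sin (Real.pi * x) ^ 2) ^ 2 - w x ^ 2) x := by
    intro x hx
    have hs := (sin_pi_mul_pos hx).ne'
    have hd := (((hasDerivAt_cos_pi_mul x).const_mul Real.pi).div
      (hasDerivAt_sin_pi_mul x) hs).add
        ((hAderiv x hx).div ((hasDerivAt_sin_pi_mul x).pow 2) (pow_ne_zero 2 hs))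
    refine hd.congr_deriv ?_
    simp only [hw, Pi.pow_apply]
    field_simp
    ring
  have huderiv : ∀ x ∈ Ioo (0 : ℝ) 1, HasDerivAt u (derivWithin u (Icc 0 1) x) x := fun x hx =>
    ((hu.differentiableOn one_ne_zero) x
      (Ioo_subset_Icc_self hx)).hasDerivWithinAt.hasDerivAt (Icc_mem_nhds hx.1 hx.2)
  obtain ⟨L, hL0, hL⟩ := exists_abs_le_mul_sin hu h0 h1
  have hFderiv : ∀ x ∈ Ioo (0 : ℝ) 1, HasDerivAt (fun x => w x * u x ^ 2)
      ((p x - P - Real.pi ^ 2 + (A x / Real.sin (Real.pi * x) ^ 2) ^ 2 - w x ^ 2) * u x ^ 2 +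
        w x * (2 * u x * derivWithin u (Icc 0 1) x)) x := by
    intro x hx
    refine ((hwderiv x hx).mul ((huderiv x hx).pow 2)).congr_deriv ?_
    simp
  have hFle : ∀ x ∈ Icc (0 : ℝ) 1,
      |w x * u x ^ 2| ≤ Real.pi * L * |u x| + M * u x ^ 2 := by
    intro x hx
    have hquot : |u x / Real.sin (Real.pi * x)| ≤ L := by
      have hs : 0 ≤ Real.sin (Real.pi * x) :=
        Real.sin_nonneg_of_nonneg_of_le_pi (mul_nonneg Real.pi_pos.le hx.1)
          (by nlinarith [Real.pi_pos, hx.2])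
      rw [abs_div, abs_of_nonneg hs]
      exact div_le_of_le_mul₀ hs hL0 (hL x hx)
    have hsplit : w x * u x ^ 2 = Real.pi * Real.cos (Real.pi * x) *
        (u x / Real.sin (Real.pi * x)) * u x + A x / Real.sin (Real.pi * x) ^ 2 * u x ^ 2 := by
      simp only [hw]
      ring
    rw [hsplit]
    refine (abs_add_le _ _).trans (add_le_add ?_ ?_)
    · rw [abs_mul, abs_mul, abs_mul, abs_of_pos Real.pi_pos]
      have hc := Real.abs_cos_le_one (Real.pi * x)
      have hpc : Real.pi * |Real.cos (Real.pi * x)| ≤ Real.pi := by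
        nlinarith [Real.pi_pos]
      gcongr
    · rw [abs_mul, abs_of_nonneg (sq_nonneg (u x))]
      exact mul_le_mul_of_nonneg_right (hgle x hx) (sq_nonneg _)
  have hFend : ∀ x ∈ Icc (0 : ℝ) 1, u x = 0 →
      ContinuousWithinAt (fun x => w x * u x ^ 2) (Icc 0 1) x := by
    intro x hx hux
    have hlim : Filter.Tendsto (fun y => Real.pi * L * |u y| + M * u y ^ 2)
        (nhdsWithin x (Icc 0 1)) (nhds 0) := by
      have : ContinuousWithinAt (fun y => Real.pi * L * |u y| + M * u y ^ 2) (Icc 0 1) x :=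
        ((hcu x hx).abs.const_mul _).add (((hcu x hx).pow 2).const_mul _)
      simpa [ContinuousWithinAt, hux] using this
    have hval : w x * u x ^ 2 = 0 := by simp [hux]
    rw [ContinuousWithinAt, hval]
    exact squeeze_zero_norm' (Filter.eventually_of_mem self_mem_nhdsWithin hFle) hlim
  have hFcont : ContinuousOn (fun x => w x * u x ^ 2) (Icc 0 1) := by
    intro x hx
    rcases eq_endpoints_or_mem_Ioo_of_mem_Icc hx with rfl | rfl | hx'
    · exact hFend 0 hx h0
    · exact hFend 1 hx h1
    · exact (hFderiv x hx').continuousAt.continuousWithinAt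
  have hci1 : ContinuousOn (fun x => (derivWithin u (Icc 0 1) x) ^ 2 + p x * u x ^ 2)
      (Icc 0 1) := (hcu'.pow 2).add (hp.mul (hcu.pow 2))
  have hci2 : ContinuousOn (fun x => (Real.pi ^ 2 + P - M ^ 2) * u x ^ 2) (Icc 0 1) :=
    (hcu.pow 2).const_mul _
  have hmain := sub_le_integral_of_hasDeriv_right_of_le zero_le_one hFcont
    (fun x hx => (hFderiv x hx).hasDerivWithinAt)
    (φ := fun x => ((derivWithin u (Icc 0 1) x) ^ 2 + p x * u x ^ 2) -
      (Real.pi ^ 2 + P - M ^ 2) * u x ^ 2)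
    ((hci1.sub hci2).integrableOn_Icc) (by
      intro x hx
      have hg : (A x / Real.sin (Real.pi * x) ^ 2) ^ 2 ≤ M ^ 2 :=
        sq_le_sq' (neg_le_of_abs_le (hgle x (Ioo_subset_Icc_self hx)))
          (le_of_abs_le (hgle x (Ioo_subset_Icc_self hx)))
      have := mul_le_mul_of_nonneg_right hg (sq_nonneg (u x))
      nlinarith [sq_nonneg (derivWithin u (Icc 0 1) x - w x * u x)])
  rw [intervalIntegral.integral_sub
    (intervalIntegrable_of_continuousOn_Icc hci1 hmem0 hmem1)
    (intervalIntegrable_of_continuousOn_Icc hci2 hmem0 hmem1),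
    intervalIntegral.integral_const_mul] at hmain
  simp only [h0, h1] at hmain
  linarith

/-- There exists a constant `C > 0` such that for every `q ∈ Q`,
`|∫₀¹ (q(x) − 1/2)·sin²(πx) dx − (1/2)·(λ(q) − π² − 1/2)| ≤ C·‖q − 1/2‖∞²`. -/
theorem sturm_liouville_integral_formula :
    ∃ C > 0, ∀ q : ℝ → ℝ, memQ q →
      |(∫ x in (0:ℝ)..1, (q x - 1/2) * (Real.sin (Real.pi * x))^2) -
          (1/2) * (lambdaSL q - Real.pi^2 - 1/2)|
        ≤ C * (supNorm (fun x => q x - 1/2))^2 := by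
  refine ⟨1 / 2, by norm_num, fun q ⟨hq01, hq2, _⟩ => ?_⟩
  have hud := uniqueDiffOn_Icc (zero_lt_one (α := ℝ))
  have hmem0 : (0 : ℝ) ∈ Icc (0 : ℝ) 1 := by simp
  have hmem1 : (1 : ℝ) ∈ Icc (0 : ℝ) 1 := by simp
  have hq : ContinuousOn q (Icc 0 1) := hq2.continuousOn
  have hp : ContinuousOn (fun x => q x - 1 / 2) (Icc 0 1) := hq.sub continuousOn_const
  set M := supNorm (fun x => q x - 1 / 2)
  have hM : ∀ x ∈ Icc (0 : ℝ) 1, |q x - 1 / 2| ≤ M := by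
    intro x hx
    refine le_ciSup (f := fun x : Icc (0 : ℝ) 1 => |q x - 1 / 2|) ⟨1 / 2, ?_⟩ ⟨x, hx⟩
    rintro _ ⟨y, rfl⟩
    have := hq01 y y.2
    exact abs_le.2 ⟨by linarith [this.1], by linarith [this.2]⟩
  set I := ∫ x in (0:ℝ)..1, (q x - 1/2) * (Real.sin (Real.pi * x))^2 with hI
  have hlower : ∀ r ∈ { r : ℝ | ∃ u : ℝ → ℝ, ContDiffOn ℝ 1 u (Set.Icc 0 1) ∧
      u 0 = 0 ∧ u 1 = 0 ∧ (∃ x ∈ Set.Icc (0:ℝ) 1, u x ≠ 0) ∧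
      r = (∫ x in (0:ℝ)..1, ((derivWithin u (Set.Icc 0 1) x)^2 + q x * (u x)^2)) /
        (∫ x in (0:ℝ)..1, (u x)^2) }, Real.pi ^ 2 + 2 * I - M ^ 2 + 1 / 2 ≤ r := by
    rintro r ⟨u, hu, h0, h1, ⟨c, hc, huc⟩, rfl⟩
    have hcu := hu.continuousOn
    have hpos : 0 < ∫ x in (0:ℝ)..1, (u x)^2 :=
      intervalIntegral.integral_pos zero_lt_one (hcu.pow 2) (fun _ _ => sq_nonneg _)
        ⟨c, hc, by positivity⟩
    have hray := rayleigh_lower_bound hp hM hu h0 h1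
    have hsplit : ∫ x in (0:ℝ)..1, ((derivWithin u (Set.Icc 0 1) x)^2 + q x * (u x)^2) =
        (∫ x in (0:ℝ)..1, ((derivWithin u (Set.Icc 0 1) x)^2 + (q x - 1 / 2) * (u x)^2)) +
          1 / 2 * ∫ x in (0:ℝ)..1, (u x)^2 := by
      have hcu2 : ContinuousOn (fun x => u x ^ 2) (Icc 0 1) := hcu.pow 2
      have hcq : ContinuousOn (fun x => (derivWithin u (Set.Icc 0 1) x)^2 +
          (q x - 1 / 2) * (u x)^2) (Icc 0 1) :=
        ((hu.continuousOn_derivWithin hud le_rfl).pow 2).add (hp.mul hcu2)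
      rw [← intervalIntegral.integral_const_mul, ← intervalIntegral.integral_add
        (intervalIntegrable_of_continuousOn_Icc hcq hmem0 hmem1)
        (intervalIntegrable_of_continuousOn_Icc (hcu2.const_mul _) hmem0 hmem1)]
      congr 1
      ext x
      ring
    rw [le_div_iff₀ hpos, hsplit, add_mul]
    linarith
  have hsin : Real.pi ^ 2 + 2 * I + 1 / 2 ∈ { r : ℝ | ∃ u : ℝ → ℝ,
      ContDiffOn ℝ 1 u (Set.Icc 0 1) ∧
      u 0 = 0 ∧ u 1 = 0 ∧ (∃ x ∈ Set.Icc (0:ℝ) 1, u x ≠ 0) ∧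
      r = (∫ x in (0:ℝ)..1, ((derivWithin u (Set.Icc 0 1) x)^2 + q x * (u x)^2)) /
        (∫ x in (0:ℝ)..1, (u x)^2) } := by
    refine ⟨fun x => Real.sin (Real.pi * x), by fun_prop, by simp, by simp,
      ⟨1 / 2, by norm_num, (sin_pi_mul_pos (by norm_num)).ne'⟩, ?_⟩
    have hcs : ContinuousOn (fun x => Real.sin (Real.pi * x) ^ 2) (Icc 0 1) := by fun_prop
    have hcc : ContinuousOn (fun x => Real.cos (Real.pi * x) ^ 2) (Icc 0 1) := by fun_prop
    have hnum : ∫ x in (0:ℝ)..1, ((derivWithin (fun x => Real.sin (Real.pi * x))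
        (Set.Icc 0 1) x)^2 + q x * (Real.sin (Real.pi * x))^2) =
        ∫ x in (0:ℝ)..1, ((Real.pi ^ 2 * Real.cos (Real.pi * x) ^ 2 +
          1 / 2 * Real.sin (Real.pi * x) ^ 2) + (q x - 1/2) * (Real.sin (Real.pi * x))^2) := by
      refine intervalIntegral.integral_congr fun x hx => ?_
      rw [uIcc_of_le zero_le_one] at hx
      simp only [(hasDerivAt_sin_pi_mul x).hasDerivWithinAt.derivWithin (hud x hx)]
      ring
    have hcsc : ContinuousOn (fun x => Real.pi ^ 2 * Real.cos (Real.pi * x) ^ 2 +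
        1 / 2 * Real.sin (Real.pi * x) ^ 2) (Icc 0 1) := by fun_prop
    have hcps : ContinuousOn (fun x => (q x - 1 / 2) * Real.sin (Real.pi * x) ^ 2) (Icc 0 1) :=
      hp.mul hcs
    rw [hnum, intervalIntegral.integral_add
      (intervalIntegrable_of_continuousOn_Icc hcsc hmem0 hmem1)
      (intervalIntegrable_of_continuousOn_Icc hcps hmem0 hmem1),
      intervalIntegral.integral_add
      (intervalIntegrable_of_continuousOn_Icc (hcc.const_mul _) hmem0 hmem1)
      (intervalIntegrable_of_continuousOn_Icc (hcs.const_mul _) hmem0 hmem1),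
      intervalIntegral.integral_const_mul, intervalIntegral.integral_const_mul,
      integral_sin_pi_mul_sq, integral_cos_pi_mul_sq, ← hI]
    ring
  have hle : lambdaSL q ≤ Real.pi ^ 2 + 2 * I + 1 / 2 := csInf_le ⟨_, hlower⟩ hsin
  have hge : Real.pi ^ 2 + 2 * I - M ^ 2 + 1 / 2 ≤ lambdaSL q := le_csInf ⟨_, hsin⟩ hlower
  exact abs_le.2 ⟨by nlinarith [sq_nonneg M], by linarith⟩
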